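/- Construction of a kernel with full cancellation (scalar case of Property 2.4): let n ≥ 1, γ ∈ (0,1], and let k : ℝ^n × ℝ^n → ℂ be a measurable kernel satisfying the smoothness estimates with Lipschitz parameter γ. For j ∈ ℤ and an integer s ≥ 0, set k_{j,s}(x,y) = 1_{x ∉ 5Q_{y,j}} (k(x,y) − k(x, c_{y,j+s−1})). Then there exist a constant C depending only on n and γ and a measurable kernel σ : ℝ^n × ℝ^n → ℂ such that: (1) σ(x,y) = k_{j,s}(x,y) whenever x ∉ 5Q_{y,j}; (2) for every x ∈ ℝ^n, the function y ↦ σ(x,y) is integrable and ∫_{ℝ^n} σ(x,y) dy = 0; (3) |σ(x,y)| ≤ C · 1_{|x−y| > 2^{−j−1}} · 2^{−(j+s)γ} / |x−y|^{n+γ} for all x, y. -/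

import Mathlib

open MeasureTheory Set
open scoped ENNReal

noncomputable section

/-- The dyadic cube of generation `m` containing `y`. -/
def dyadicCube (n : ℕ) (m : ℤ) (y : Fin n → ℝ) : Set (Fin n → ℝ) :=
  {z | ∀ i, ⌊(2:ℝ) ^ m * y i⌋ = ⌊(2:ℝ) ^ m * z i⌋}

/-- The center of the dyadic cube of generation `m` containing `y`. -/
def cubeCenter (n : ℕ) (m : ℤ) (y : Fin n → ℝ) : Fin n → ℝ :=
  fun i => (2:ℝ) ^ (-m) * (⌊(2:ℝ) ^ m * y i⌋ + 1/2)

/-- The `d`-fold dilation of the dyadic cube of generation `m` containing `y`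
(for the sup norm, which is the norm on `Fin n → ℝ`). -/
def dilatedCube (n : ℕ) (d : ℕ) (m : ℤ) (y : Fin n → ℝ) : Set (Fin n → ℝ) :=
  {z | ‖z - cubeCenter n m y‖ < d * (2:ℝ) ^ (-m) / 2}

/-- The dyadic cube of generation `m` with lower-left corner `2^{-m} a`. -/
def dyadicCubeOf (n : ℕ) (m : ℤ) (a : Fin n → ℤ) : Set (Fin n → ℝ) :=
  {z | ∀ i, (2:ℝ) ^ (-m) * a i ≤ z i ∧ z i < (2:ℝ) ^ (-m) * (a i + 1)}

/-- Center of the dyadic cube of generation `m` with lower-left corner `2^{-m} a`. -/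
def cubeCenterOf (n : ℕ) (m : ℤ) (a : Fin n → ℤ) : Fin n → ℝ :=
  fun i => (2:ℝ) ^ (-m) * (a i + 1/2)

/-- `d`-fold dilation of the dyadic cube of generation `m` with corner `2^{-m} a`. -/
def dilatedCubeOf (n : ℕ) (d : ℕ) (m : ℤ) (a : Fin n → ℤ) : Set (Fin n → ℝ) :=
  {z | ‖z - cubeCenterOf n m a‖ < d * (2:ℝ) ^ (-m) / 2}

/-- Dyadic conditional expectation `E_m f (x) = 2^{mn} ∫_{Q_{x,m}} f`. -/
def dyadicAvg (n : ℕ) (m : ℤ) (f : (Fin n → ℝ) → ℂ) (x : Fin n → ℝ) : ℂ :=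
  (2:ℝ) ^ (m * (n:ℤ)) • ∫ t in dyadicCube n m x, f t

/-- Martingale difference `Δ_m f = E_m f - E_{m-1} f`. -/
def dyadicDiff (n : ℕ) (m : ℤ) (f : (Fin n → ℝ) → ℂ) : (Fin n → ℝ) → ℂ :=
  fun x => dyadicAvg n m f x - dyadicAvg n (m - 1) f x

/-- Smoothness estimates with Lipschitz parameter `γ`, for the sup norm on `ℝ^n`. -/
def SmoothKernel (n : ℕ) (γ : ℝ) (k : (Fin n → ℝ) → (Fin n → ℝ) → ℂ) : Prop :=
  ∀ x y z : Fin n → ℝ, ‖x - z‖ ≤ (1/2) * ‖y - z‖ →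
    ‖k x y - k z y‖ ≤ ‖x - z‖ ^ γ / ‖y - z‖ ^ ((n:ℝ) + γ) ∧
    ‖k y x - k y z‖ ≤ ‖x - z‖ ^ γ / ‖y - z‖ ^ ((n:ℝ) + γ)

/-- Size condition `‖k(x,y)‖ ≤ |x-y|^{-n}`. -/
def SizeKernel (n : ℕ) (k : (Fin n → ℝ) → (Fin n → ℝ) → ℂ) : Prop :=
  ∀ x y : Fin n → ℝ, x ≠ y → ‖k x y‖ ≤ ‖x - y‖ ^ (-(n:ℝ))

lemma norm_sub_cubeCenter_le (n : ℕ) (m : ℤ) (y : Fin n → ℝ) :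
    ‖y - cubeCenter n m y‖ ≤ (2:ℝ) ^ (-m) / 2 := by
  have h2 : (0:ℝ) < 2 ^ (-m) := by positivity
  refine (pi_norm_le_iff_of_nonneg (by positivity)).2 fun i => ?_
  have hy : y i = (2:ℝ) ^ (-m) * ((2:ℝ) ^ m * y i) := by
    rw [← mul_assoc, ← zpow_add₀ two_ne_zero]
    simp
  have h1 := Int.floor_le ((2:ℝ) ^ m * y i)
  have h3 := Int.lt_floor_add_one ((2:ℝ) ^ m * y i)
  simp only [Pi.sub_apply, cubeCenter, Real.norm_eq_abs]
  generalize (⌊(2:ℝ) ^ m * y i⌋ : ℝ) = a at *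
  rw [hy, ← mul_sub, abs_mul, abs_of_pos h2, div_eq_mul_one_div (2 ^ (-m) : ℝ)]
  gcongr
  rw [abs_le]
  constructor <;> linarith

lemma two_mul_le_norm_sub_of_notMem_dilatedCube {n : ℕ} {j : ℤ} {x y : Fin n → ℝ}
    (h : x ∉ dilatedCube n 5 j y) : 2 * (2:ℝ) ^ (-j) ≤ ‖x - y‖ := by
  have h1 : ¬ ‖x - cubeCenter n j y‖ < (5 : ℕ) * (2:ℝ) ^ (-j) / 2 := h
  have h2 := norm_sub_cubeCenter_le n j y
  have h3 := norm_sub_le_norm_sub_add_norm_sub x y (cubeCenter n j y)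
  push_cast at h1
  linarith

lemma measurable_cubeCenter (n : ℕ) (m : ℤ) : Measurable (cubeCenter n m) := by
  unfold cubeCenter
  fun_prop

lemma measurableSet_prod_dilatedCube (n d : ℕ) (m : ℤ) :
    MeasurableSet {p : (Fin n → ℝ) × (Fin n → ℝ) | p.1 ∈ dilatedCube n d m p.2} := by
  have := measurable_cubeCenter n m
  exact measurableSet_lt (f := fun p : (Fin n → ℝ) × (Fin n → ℝ) => ‖p.1 - cubeCenter n m p.2‖)
    (by fun_prop) measurable_const

lemma SmoothKernel.norm_sub_cubeCenter_le {n : ℕ} {γ : ℝ} {k : (Fin n → ℝ) → (Fin n → ℝ) → ℂ}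
    (hk : SmoothKernel n γ k) (hγ0 : 0 < γ) (j : ℤ) (s : ℕ) {x y : Fin n → ℝ}
    (h : 2 * (2:ℝ) ^ (-j) ≤ ‖x - y‖) :
    ‖k x y - k x (cubeCenter n (j + s - 1) y)‖ ≤
      2 ^ (-((j:ℝ) + s) * γ) / ‖x - y‖ ^ ((n:ℝ) + γ) := by
  have hc : ‖cubeCenter n (j + s - 1) y - y‖ ≤ (2:ℝ) ^ (-(j + s : ℤ)) := by
    rw [norm_sub_rev]
    refine (_root_.norm_sub_cubeCenter_le n _ y).trans_eq ?_
    rw [show (-(j + s - 1) : ℤ) = -(j + s) + 1 by ring, zpow_add_one₀ two_ne_zero]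
    ring
  have hle : (2:ℝ) ^ (-(j + s : ℤ)) ≤ 2 ^ (-j) :=
    zpow_le_zpow_right₀ one_le_two (by lia)
  have hk' := (hk (cubeCenter n (j + s - 1) y) x y (by linarith)).2
  rw [norm_sub_rev] at hk'
  refine hk'.trans ?_
  rw [Real.rpow_mul zero_le_two]
  have he : (2:ℝ) ^ (-((j:ℝ) + s)) = (2:ℝ) ^ (-(j + s : ℤ)) := by
    rw [← Real.rpow_intCast]
    push_cast
    rfl
  rw [he]
  gcongr

lemma integrable_one_add_norm_smul_sub {n : ℕ} {p : ℝ} (hp : (n:ℝ) < p) {r : ℝ} (hr : 0 < r)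
    (x : Fin n → ℝ) : Integrable (fun y : Fin n → ℝ => (1 + ‖r⁻¹ • (x - y)‖) ^ (-p)) := by
  have h := integrable_one_add_norm (E := Fin n → ℝ) (μ := volume) (r := p) (by simpa using hp)
  exact (h.comp_smul (inv_ne_zero hr.ne')).comp_sub_left x

lemma integral_one_add_norm_smul_sub {n : ℕ} (p : ℝ) {r : ℝ} (hr : 0 < r) (x : Fin n → ℝ) :
    ∫ y : Fin n → ℝ, (1 + ‖r⁻¹ • (x - y)‖) ^ (-p) =
      r ^ n * ∫ y : Fin n → ℝ, (1 + ‖y‖) ^ (-p) := by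
  rw [integral_sub_left_eq_self (fun y : Fin n → ℝ => (1 + ‖r⁻¹ • y‖) ^ (-p)) volume x,
    Measure.integral_comp_smul volume (fun y : Fin n → ℝ => (1 + ‖y‖) ^ (-p))]
  simp [abs_of_pos hr]

/-- A measurable kernel supported in `2 * r ≤ ‖x - y‖` and decaying like `‖x - y‖ ^ (-p)`, `n < p`,
can be modified on `‖x - y‖ < 2 * r` to have vanishing integrals, keeping its decay. -/
lemma exists_cancellation_of_decay {n : ℕ} (hn : 1 ≤ n) {p : ℝ} (hp : (n:ℝ) < p) {r B : ℝ}
    (hr : 0 < r) (hB : 0 ≤ B) {K : (Fin n → ℝ) → (Fin n → ℝ) → ℂ}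
    (hK : Measurable (Function.uncurry K)) (hK0 : ∀ x y, ‖x - y‖ < 2 * r → K x y = 0)
    (hKB : ∀ x y, 2 * r ≤ ‖x - y‖ → ‖K x y‖ ≤ B / ‖x - y‖ ^ p) :
    ∃ σ : (Fin n → ℝ) → (Fin n → ℝ) → ℂ, Measurable (Function.uncurry σ) ∧
      (∀ x y, 2 * r ≤ ‖x - y‖ → σ x y = K x y) ∧
      (∀ x, Integrable (σ x) ∧ ∫ y, σ x y = 0) ∧
      ∀ x y, ‖σ x y‖ ≤ if r / 2 < ‖x - y‖ then
        (4 ^ p * (∫ y : Fin n → ℝ, (1 + ‖y‖) ^ (-p)) + 1) * B / ‖x - y‖ ^ p else 0 := by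
  set I := ∫ y : Fin n → ℝ, (1 + ‖y‖) ^ (-p)
  have hI : 0 ≤ I := integral_nonneg fun y => by positivity
  have hp0 : 0 < p := (Nat.cast_nonneg n).trans_lt hp
  have hdom : ∀ x y, ‖K x y‖ ≤ B * (2 / r) ^ p * (1 + ‖r⁻¹ • (x - y)‖) ^ (-p) := by
    intro x y
    rcases lt_or_ge ‖x - y‖ (2 * r) with h | h
    · rw [hK0 x y h, norm_zero]
      positivity
    · refine (hKB x y h).trans ?_
      rw [mul_assoc, div_eq_mul_inv, Real.rpow_neg (by positivity), ← Real.inv_rpow (by positivity),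
        ← Real.inv_rpow (by positivity), ← Real.mul_rpow (by positivity) (by positivity),
        ← div_eq_mul_inv]
      gcongr
      rw [norm_smul, norm_inv, Real.norm_of_nonneg hr.le, div_div, mul_add, mul_one,
        mul_inv_cancel_left₀ hr.ne', inv_eq_one_div, div_le_div_iff₀ (by linarith) (by positivity)]
      linarith
  have hKx : ∀ x, Measurable (K x) := fun x => hK.comp measurable_prodMk_left
  have hKint : ∀ x, Integrable (K x) := fun x =>
    ((integrable_one_add_norm_smul_sub hp hr x).const_mul _).mono' (hKx x).aestronglyMeasurable
      (.of_forall (hdom x))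
  have hKI : ∀ x, ‖∫ y, K x y‖ ≤ B * (2 / r) ^ p * (r ^ n * I) := fun x => by
    rw [← integral_one_add_norm_smul_sub p hr x, ← integral_const_mul]
    exact norm_integral_le_of_norm_le
      ((integrable_one_add_norm_smul_sub hp hr x).const_mul _) (.of_forall (hdom x))
  let A : (Fin n → ℝ) → Set (Fin n → ℝ) := fun x => Metric.ball (x + fun _ => r) (r / 2)
  have hA : ∀ x y, y ∈ A x → r / 2 < ‖x - y‖ ∧ ‖x - y‖ < 2 * r := by
    intro x y hy
    have : Nonempty (Fin n) := ⟨⟨0, hn⟩⟩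
    have h1 : ‖y - (x + fun _ => r)‖ < r / 2 := mem_ball_iff_norm.1 hy
    have h2 : ‖(fun _ => r : Fin n → ℝ)‖ = r := by
      rw [pi_norm_const, Real.norm_of_nonneg hr.le]
    have h3 : (fun _ => r : Fin n → ℝ) = -(x - y) - (y - (x + fun _ => r)) := by abel
    have h4 : x - y = -(fun _ => r) - (y - (x + fun _ => r)) := by abel
    constructor
    · have := norm_sub_le (-(x - y)) (y - (x + fun _ => r))
      rw [← h3, norm_neg, h2] at this
      linarith
    · have := norm_sub_le (-(fun _ => r : Fin n → ℝ)) (y - (x + fun _ => r))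
      rw [← h4, norm_neg, h2] at this
      linarith
  have hAvol : ∀ x, volume.real (A x) = r ^ n := fun x => by
    rw [Measure.real, Real.volume_pi_ball _ (by positivity), ENNReal.toReal_ofReal (by positivity),
      mul_div_cancel₀ _ two_ne_zero, Fintype.card_fin]
  have hAint : ∀ (x : Fin n → ℝ) (c : ℂ), Integrable ((A x).indicator fun _ => c) := fun x c =>
    (integrable_indicator_iff Metric.isOpen_ball.measurableSet).2
      (integrableOn_const Metric.isBounded_ball.measure_lt_top.ne)
  refine ⟨fun x y => K x y - (A x).indicator (fun _ => ((r ^ n)⁻¹ : ℝ) • ∫ z, K x z) y,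
    ?_, fun x y h => ?_, fun x => ⟨(hKint x).sub (hAint x _), ?_⟩, fun x y => ?_⟩
  · refine hK.sub ?_
    have hAm : MeasurableSet {q : (Fin n → ℝ) × (Fin n → ℝ) | q.2 ∈ A q.1} :=
      measurableSet_lt
        (f := fun q : (Fin n → ℝ) × (Fin n → ℝ) => dist q.2 (q.1 + fun _ => r))
        (by fun_prop) measurable_const
    have hKm : Measurable fun x => ∫ z, K x z :=
      (hK.stronglyMeasurable.integral_prod_right (ν := volume)).measurable
    exact Measurable.indicator (f := fun q => ((r ^ n)⁻¹ : ℝ) • ∫ z, K q.1 z)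
      ((hKm.comp measurable_fst).const_smul (r ^ n)⁻¹) hAm
  · have : y ∉ A x := fun hy => ((hA x y hy).2.trans_le h).false
    simp [this]
  · rw [integral_sub (hKint x) (hAint x _), integral_indicator Metric.isOpen_ball.measurableSet,
      setIntegral_const, hAvol, smul_inv_smul₀ (by positivity), sub_self]
  · have hsmul : ‖((r ^ n)⁻¹ : ℝ) • ∫ z, K x z‖ ≤ B * (2 / r) ^ p * I := by
      rw [norm_smul, Real.norm_of_nonneg (by positivity), inv_mul_le_iff₀ (by positivity)]
      exact (hKI x).trans_eq (by ring)
    by_cases hy : y ∈ A x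
    · obtain ⟨h1, h2⟩ := hA x y hy
      have hpos : 0 < ‖x - y‖ := by linarith
      simp only [hK0 x y h2, indicator_of_mem hy, zero_sub, norm_neg, if_pos h1]
      refine hsmul.trans ?_
      have h4 : (2 / r) ^ p ≤ 4 ^ p / ‖x - y‖ ^ p := by
        rw [← Real.div_rpow (by positivity) (by positivity)]
        gcongr 1
        rw [div_le_div_iff₀ hr hpos]
        linarith
      calc B * (2 / r) ^ p * I ≤ B * (4 ^ p / ‖x - y‖ ^ p) * I := by gcongr
        _ = (4 ^ p * I) * B / ‖x - y‖ ^ p := by ring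
        _ ≤ _ := by gcongr; linarith
    · simp only [indicator_of_notMem hy, sub_zero]
      rcases lt_or_ge ‖x - y‖ (2 * r) with h | h
      · rw [hK0 x y h, norm_zero]
        split_ifs <;> positivity
      · rw [if_pos (by linarith)]
        refine (hKB x y h).trans ?_
        gcongr
        exact le_mul_of_one_le_left hB (le_add_of_nonneg_left (by positivity))

/-- Construction of a kernel with full cancellation: there is a
measurable kernel `σ` agreeing with `k_{j,s}` off the dilated cubes, with vanishing
`y`-integrals, and with the pointwise bound
`|σ(x,y)| ≤ C · 1_{|x-y| > 2^{-j-1}} · 2^{-(j+s)γ} / |x-y|^{n+γ}`. -/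
theorem cancellation_kernel_exists (n : ℕ) (hn : 1 ≤ n) (γ : ℝ)
    (hγ0 : 0 < γ) (hγ1 : γ ≤ 1) :
    ∃ C : ℝ, 0 < C ∧
      ∀ k : (Fin n → ℝ) → (Fin n → ℝ) → ℂ,
        Measurable (Function.uncurry k) → SmoothKernel n γ k →
        ∀ (j : ℤ) (s : ℕ),
          ∃ σ : (Fin n → ℝ) → (Fin n → ℝ) → ℂ,
            Measurable (Function.uncurry σ) ∧
            (∀ x y : Fin n → ℝ, x ∉ dilatedCube n 5 j y →
              σ x y = k x y - k x (cubeCenter n (j + s - 1) y)) ∧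
            (∀ x : Fin n → ℝ, Integrable (fun y => σ x y) volume ∧
              ∫ y, σ x y = 0) ∧
            (∀ x y : Fin n → ℝ, ‖σ x y‖ ≤
              if (2:ℝ) ^ (-j - 1) < ‖x - y‖ then
                C * 2 ^ (-((j:ℝ) + s) * γ) / ‖x - y‖ ^ ((n:ℝ) + γ)
              else 0) := by
  have hI : 0 ≤ ∫ y : Fin n → ℝ, (1 + ‖y‖) ^ (-((n:ℝ) + γ)) :=
    integral_nonneg fun y => by positivity
  refine ⟨4 ^ ((n:ℝ) + γ) * (∫ y : Fin n → ℝ, (1 + ‖y‖) ^ (-((n:ℝ) + γ))) + 1, by positivity,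
    fun k hkm hk j s => ?_⟩
  classical
  let K : (Fin n → ℝ) → (Fin n → ℝ) → ℂ := fun x y =>
    if x ∈ dilatedCube n 5 j y then 0 else k x y - k x (cubeCenter n (j + s - 1) y)
  have hK : Measurable (Function.uncurry K) := by
    have hc := measurable_cubeCenter n (j + s - 1)
    refine Measurable.ite (measurableSet_prod_dilatedCube n 5 j) measurable_const (hkm.sub ?_)
    exact hkm.comp (measurable_fst.prodMk (hc.comp measurable_snd))
  obtain ⟨σ, hσm, hσK, hσI, hσB⟩ := exists_cancellation_of_decay hn (lt_add_of_pos_right _ hγ0)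
    (r := (2:ℝ) ^ (-j)) (B := 2 ^ (-((j:ℝ) + s) * γ)) (by positivity) (by positivity) hK
    (fun x y h => if_pos <| by
      by_contra hx
      exact h.not_ge (two_mul_le_norm_sub_of_notMem_dilatedCube hx))
    (fun x y h => by
      by_cases hx : x ∈ dilatedCube n 5 j y
      · simp only [K, if_pos hx, norm_zero]
        positivity
      · simp only [K, if_neg hx]
        exact hk.norm_sub_cubeCenter_le hγ0 j s h)
  refine ⟨σ, hσm, fun x y hx => ?_, hσI, fun x y => ?_⟩
  · rw [hσK x y (two_mul_le_norm_sub_of_notMem_dilatedCube hx)]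
    exact if_neg hx
  · rw [zpow_sub_one₀ two_ne_zero, ← div_eq_mul_inv]
    exact hσB x y
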